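/- arXiv:math/0110157 — 2 statements merged into one kernel-verified Lean document; each statement's English description precedes it below -/
import Mathlib

section
/- Let e₁ ∈ ℂ³ be nonzero, let F be a 3×3 complex matrix, let φ₁, φ₂ be homogeneous polynomials in ℂ[x₀,x₁,x₂] of the same degree m with φ₂ irreducible, and let λ ∈ ℂ be nonzero. Suppose that φ₂(F p) = λ φ₁(e₁ × p) for all p ∈ ℂ³, that there exists p₀ ∈ ℂ³ with φ₁(e₁ × p₀) ≠ 0, and that there exist two distinct lines through e₁ contained in the zero set of p ↦ φ₁(e₁ × p), i.e. there exist a, b ∈ ℂ³ with φ₁(e₁ × a) = φ₁(e₁ × b) = 0, a not in the span of {e₁}, and b not in the span of {e₁, a}. Then F has rank 2 and F e₁ = 0. -/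
open Matrix MvPolynomial

/-- Evaluation of a homogeneous polynomial at a rescaled point. -/
lemma MvPolynomial.IsHomogeneous.eval_smul_eq {σ R : Type*} [Fintype σ] [CommSemiring R]
    {φ : MvPolynomial σ R} {m : ℕ} (h : φ.IsHomogeneous m) (t : R) (x : σ → R) :
    eval (t • x) φ = t ^ m * eval x φ := by
  rw [eval_eq', eval_eq', Finset.mul_sum]
  refine Finset.sum_congr rfl fun d hd => ?_
  have hdeg : ∑ i, d i = m := by
    rw [← h (mem_support_iff.mp hd), Finsupp.weight_apply, Finsupp.sum_fintype _ _ (by simp)]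
    simp
  simp only [Pi.smul_apply, smul_eq_mul, mul_pow, Finset.prod_mul_distrib]
  rw [Finset.prod_pow_eq_pow_sum, hdeg]
  ring

/-- Setting the variable `X i` to zero changes a polynomial by a multiple of `X i`. -/
lemma MvPolynomial.X_dvd_sub_bind₁_update {σ R : Type*} [DecidableEq σ] [CommRing R] (i : σ)
    (p : MvPolynomial σ R) :
    X i ∣ p - bind₁ (Function.update (X : σ → MvPolynomial σ R) i 0) p := by
  induction p using MvPolynomial.induction_on with
  | C r => simp
  | add p q hp hq =>
    rw [map_add, add_sub_add_comm]
    exact dvd_add hp hq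
  | mul_X p j hp =>
    set q := bind₁ (Function.update (X : σ → MvPolynomial σ R) i 0) p
    have hj : (X i : MvPolynomial σ R) ∣ X j - Function.update (X : σ → MvPolynomial σ R) i 0 j := by
      obtain rfl | hij := eq_or_ne j i
      · simp
      · simp [hij]
    rw [map_mul, bind₁_X_right]
    convert dvd_add (hp.mul_right (X j)) (hj.mul_left q) using 1
    ring

/-- A polynomial vanishing on a coordinate hyperplane is divisible by that coordinate. -/
lemma MvPolynomial.X_dvd_of_eval_eq_zero {σ R : Type*} [CommRing R] [IsDomain R]
    [Infinite R] (i : σ) (p : MvPolynomial σ R)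
    (h : ∀ x : σ → R, x i = 0 → eval x p = 0) : X i ∣ p := by
  classical
  have hzero : bind₁ (Function.update (X : σ → MvPolynomial σ R) i 0) p = 0 := by
    refine MvPolynomial.funext fun x => ?_
    rw [map_zero, ← coe_aeval_eq_eval, RingHom.coe_coe, aeval_bind₁]
    refine h _ ?_
    simp
  simpa [hzero] using X_dvd_sub_bind₁_update i p

/-- The linear substitution of variables attached to a matrix. -/
noncomputable def linearSubst {n R : Type*} [Fintype n] [CommSemiring R] (M : Matrix n n R) :
    MvPolynomial n R →ₐ[R] MvPolynomial n R :=
  bind₁ fun i => ∑ j, C (M i j) * X j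

lemma eval_linearSubst {n R : Type*} [Fintype n] [CommSemiring R] (M : Matrix n n R)
    (p : MvPolynomial n R) (x : n → R) :
    eval x (linearSubst M p) = eval (M *ᵥ x) p := by
  rw [← coe_aeval_eq_eval, RingHom.coe_coe, linearSubst, aeval_bind₁, ← coe_aeval_eq_eval,
    RingHom.coe_coe]
  congr 2
  funext i
  simp [Matrix.mulVec, dotProduct]

/-- An irreducible polynomial vanishing on the hyperplane spanned by all columns but one of an
invertible matrix does not vanish at the remaining column. -/
lemma Irreducible.eval_mulVec_single_ne_zero {n K : Type*} [Fintype n] [DecidableEq n] [Field K]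
    [Infinite K] {φ : MvPolynomial n K} (hφ : Irreducible φ) {M : Matrix n n K} (hM : IsUnit M)
    (i : n) (h : ∀ x : n → K, x i = 0 → eval (M *ᵥ x) φ = 0) :
    eval (M *ᵥ Pi.single i 1) φ ≠ 0 := by
  have hdet : IsUnit M.det := (Matrix.isUnit_iff_isUnit_det M).mp hM
  obtain ⟨g, hg⟩ : X i ∣ linearSubst M φ :=
    X_dvd_of_eval_eq_zero i _ fun x hx => by rw [eval_linearSubst, h x hx]
  have hfac : φ = linearSubst M⁻¹ (X i) * linearSubst M⁻¹ g := by
    rw [← map_mul, ← hg]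
    refine MvPolynomial.funext fun x => ?_
    rw [eval_linearSubst, eval_linearSubst, mulVec_mulVec, mul_nonsing_inv _ hdet, one_mulVec]
  have hL : ¬ IsUnit (linearSubst M⁻¹ (X i : MvPolynomial n K)) := fun hu => by
    have h0 := (hu.map (eval (0 : n → K))).ne_zero
    rw [eval_linearSubst] at h0
    simp at h0
  have hu := (hφ.isUnit_or_isUnit hfac).resolve_left hL
  rw [hfac, map_mul, eval_linearSubst, mulVec_mulVec, nonsing_inv_mul _ hdet, one_mulVec]
  simpa using (hu.map (eval (M *ᵥ Pi.single i 1))).ne_zero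

/-- The matrix whose columns are three vectors in general position is invertible. -/
lemma isUnit_transpose_of_notMem_span {K : Type*} [Field K] {u v w : Fin 3 → K} (hu : u ≠ 0)
    (hv : v ∉ Submodule.span K {u}) (hw : w ∉ Submodule.span K {u, v}) :
    IsUnit (Matrix.of ![u, v, w])ᵀ := by
  rw [Matrix.isUnit_transpose, ← Matrix.linearIndependent_rows_iff_isUnit]
  have huv : LinearIndependent K ![u, v] := by
    rw [LinearIndependent.pair_iff' hu]
    rintro c rfl
    exact hv (Submodule.smul_mem _ _ (Submodule.mem_span_singleton_self u))
  have hsnoc : (Matrix.of ![u, v, w]).row = Fin.snoc ![u, v] w := by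
    funext i
    fin_cases i <;> rfl
  rw [hsnoc]
  exact linearIndependent_finSnoc.mpr
    ⟨huv, by simpa [Matrix.range_cons, Set.pair_comm v u] using hw⟩

theorem stmt3 (e₁ : Fin 3 → ℂ) (he₁ : e₁ ≠ 0) (F : Matrix (Fin 3) (Fin 3) ℂ)
    (m : ℕ) (φ₁ φ₂ : MvPolynomial (Fin 3) ℂ)
    (h₁ : φ₁.IsHomogeneous m) (h₂ : φ₂.IsHomogeneous m) (hirr : Irreducible φ₂)
    (lam : ℂ) (hlam : lam ≠ 0)
    (hKruppa : ∀ p : Fin 3 → ℂ,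
      eval (F *ᵥ p) φ₂ = lam * eval (crossProduct e₁ p) φ₁)
    (p₀ : Fin 3 → ℂ) (hp₀ : eval (crossProduct e₁ p₀) φ₁ ≠ 0)
    (a b : Fin 3 → ℂ)
    (ha : eval (crossProduct e₁ a) φ₁ = 0) (hb : eval (crossProduct e₁ b) φ₁ = 0)
    (haspan : a ∉ Submodule.span ℂ ({e₁} : Set (Fin 3 → ℂ)))
    (hbspan : b ∉ Submodule.span ℂ ({e₁, a} : Set (Fin 3 → ℂ))) :
    F.rank = 2 ∧ F *ᵥ e₁ = 0 := by
  have hB := isUnit_transpose_of_notMem_span he₁ haspan hbspan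
  set B : Matrix (Fin 3) (Fin 3) ℂ := (Matrix.of ![e₁, a, b])ᵀ with hBdef
  have hBmul (c : Fin 3 → ℂ) : B *ᵥ c = c 0 • e₁ + c 1 • a + c 2 • b := by
    funext i
    simp [hBdef, Matrix.mulVec, dotProduct, Fin.sum_univ_three, mul_comm]
  have hcoord (v : Fin 3 → ℂ) : ∃ c : Fin 3 → ℂ, v = c 0 • e₁ + c 1 • a + c 2 • b :=
    ⟨B⁻¹ *ᵥ v, by
      rw [← hBmul, mulVec_mulVec, mul_nonsing_inv _ ((Matrix.isUnit_iff_isUnit_det B).mp hB),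
        one_mulVec]⟩
  have hline {v : Fin 3 → ℂ} (hv : eval (crossProduct e₁ v) φ₁ = 0) (r s : ℂ) :
      eval (F *ᵥ (r • e₁ + s • v)) φ₂ = 0 := by
    rw [hKruppa, map_add, map_smul, map_smul, cross_self, smul_zero, zero_add,
      h₁.eval_smul_eq, hv, mul_zero, mul_zero]
  have hdet : F.det = 0 := by
    by_contra hF
    have hM : IsUnit (F * B) :=
      ((Matrix.isUnit_iff_isUnit_det F).mpr (isUnit_iff_ne_zero.mpr hF)).mul hB
    refine hirr.eval_mulVec_single_ne_zero hM 2 (fun x hx => ?_) ?_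
    · rw [← mulVec_mulVec, hBmul, hx, zero_smul, add_zero]
      exact hline ha _ _
    · rw [← mulVec_mulVec, hBmul]
      simpa using hline hb 0 1
  have hker (k : Fin 3 → ℂ) (hk : F *ᵥ k = 0) : ∃ r : ℂ, k = r • e₁ := by
    have hpk (t : ℂ) : eval (F *ᵥ (p₀ - t • k)) φ₂ ≠ 0 := by
      rw [mulVec_sub, mulVec_smul, hk, smul_zero, sub_zero, hKruppa]
      exact mul_ne_zero hlam hp₀
    obtain ⟨c, hc⟩ := hcoord k
    obtain ⟨d, hd⟩ := hcoord p₀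
    have hc1 : c 1 = 0 := by
      by_contra hne
      refine hpk (d 1 / c 1) ?_
      have heq : p₀ - (d 1 / c 1) • k =
          (d 0 - d 1 / c 1 * c 0) • e₁ + (d 2 - d 1 / c 1 * c 2) • b := by
        rw [hc, hd]
        funext i
        simp only [Pi.sub_apply, Pi.add_apply, Pi.smul_apply, smul_eq_mul]
        field_simp
        ring
      rw [heq]
      exact hline hb _ _
    have hc2 : c 2 = 0 := by
      by_contra hne
      refine hpk (d 2 / c 2) ?_
      have heq : p₀ - (d 2 / c 2) • k =
          (d 0 - d 2 / c 2 * c 0) • e₁ + (d 1 - d 2 / c 2 * c 1) • a := by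
        rw [hc, hd]
        funext i
        simp only [Pi.sub_apply, Pi.add_apply, Pi.smul_apply, smul_eq_mul]
        field_simp
        ring
      rw [heq]
      exact hline ha _ _
    exact ⟨c 0, by simpa [hc1, hc2] using hc⟩
  have hFe : F *ᵥ e₁ = 0 := by
    obtain ⟨k, hk0, hk⟩ := Matrix.exists_mulVec_eq_zero_iff.mpr hdet
    obtain ⟨r, rfl⟩ := hker k hk
    rw [mulVec_smul] at hk
    exact (smul_eq_zero.mp hk).resolve_left fun hr => hk0 (by rw [hr, zero_smul])
  refine ⟨?_, hFe⟩
  have hkerspan : LinearMap.ker F.mulVecLin = Submodule.span ℂ {e₁} := by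
    ext k
    rw [LinearMap.mem_ker, mulVecLin_apply, Submodule.mem_span_singleton]
    constructor
    · intro hk
      obtain ⟨r, hr⟩ := hker k hk
      exact ⟨r, hr.symm⟩
    · rintro ⟨r, rfl⟩
      rw [mulVec_smul, hFe, smul_zero]
  have hrn := F.mulVecLin.finrank_range_add_finrank_ker
  rw [hkerspan, finrank_span_singleton he₁, Module.finrank_fin_fun] at hrn
  rw [Matrix.rank]
  omega
end

section
/- There exist linearly independent vectors u, v ∈ ℂ⁴ and seven nonzero points p₁, …, p₇ ∈ ℂ⁴ such that the only homogeneous polynomial q of degree 2 in ℂ[x₀,x₁,x₂,x₃] satisfying q(s•u + t•v) = 0 for all s, t ∈ ℂ and q(pᵢ) = 0 for i = 1, …, 7 is the zero polynomial. -/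
open MvPolynomial

/-- An exponent vector of degree two is a sum of two unit vectors. -/
theorem Finsupp.exists_single_add_single_of_degree_eq_two {σ : Type*} {d : σ →₀ ℕ}
    (hd : d.degree = 2) : ∃ a b, d = Finsupp.single a 1 + Finsupp.single b 1 := by
  classical
  have hcard : Multiset.card (Finsupp.toMultiset d) = 2 := by
    rw [Finsupp.card_toMultiset, ← hd]
    rfl
  obtain ⟨a, b, hab⟩ := Multiset.card_eq_two.mp hcard
  refine ⟨a, b, Multiset.toFinsupp.symm.injective ?_⟩
  change Finsupp.toMultiset d = Finsupp.toMultiset _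
  rw [hab, map_add, Finsupp.toMultiset_single, Finsupp.toMultiset_single, one_smul, one_smul]
  rfl

/-- A quadratic form is given by a (not necessarily symmetric) matrix of coefficients. -/
theorem MvPolynomial.IsHomogeneous.exists_eq_sum_of_two {σ R : Type*} [Fintype σ]
    [CommSemiring R] {q : MvPolynomial σ R} (hq : q.IsHomogeneous 2) :
    ∃ c : σ → σ → R, q = ∑ a, ∑ b, C (c a b) * (X a * X b) := by
  classical
  have key : ∀ s : Finset (σ →₀ ℕ), (∀ d ∈ s, d.degree = 2) →
      ∃ c : σ → σ → R, ∑ d ∈ s, monomial d (coeff d q) =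
        ∑ a, ∑ b, C (c a b) * (X a * X b) := by
    intro s
    induction s using Finset.induction_on with
    | empty => exact fun _ => ⟨0, by simp⟩
    | insert d s hds ih =>
      intro hs
      obtain ⟨c, hc⟩ := ih fun e he => hs e (Finset.mem_insert_of_mem he)
      obtain ⟨a, b, hab⟩ := Finsupp.exists_single_add_single_of_degree_eq_two
        (hs d (Finset.mem_insert_self d s))
      refine ⟨fun i j => (if i = a then if j = b then coeff d q else 0 else 0) + c i j, ?_⟩
      have hmon : monomial d (coeff d q) = C (coeff d q) * (X a * X b) := by
        rw [X, X, monomial_mul, C_mul_monomial, ← hab, mul_one, mul_one]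
      rw [Finset.sum_insert hds, hc, hmon]
      simp only [C_add, add_mul, Finset.sum_add_distrib, apply_ite C, C_0, ite_mul, zero_mul]
      simp
  obtain ⟨c, hc⟩ := key q.support fun d hd => by
    rw [Finsupp.degree_eq_weight_one]
    exact hq (mem_support_iff.mp hd)
  exact ⟨c, by rw [← hc, ← q.as_sum]⟩

theorem stmt6 : ∃ (u v : Fin 4 → ℂ) (p : Fin 7 → (Fin 4 → ℂ)),
    LinearIndependent ℂ ![u, v] ∧ (∀ i, p i ≠ 0) ∧
      ∀ q : MvPolynomial (Fin 4) ℂ, q.IsHomogeneous 2 →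
        (∀ s t : ℂ, eval (s • u + t • v) q = 0) →
        (∀ i, eval (p i) q = 0) → q = 0 := by
  refine ⟨![1, 0, 0, 0], ![0, 1, 0, 0],
    ![![0, 0, 1, 0], ![0, 0, 0, 1], ![0, 0, 1, 1], ![1, 0, 1, 0], ![1, 0, 0, 1],
      ![0, 1, 1, 0], ![0, 1, 0, 1]], ?_, ?_, ?_⟩
  · rw [LinearIndependent.pair_iff]
    intro s t h
    exact ⟨by simpa using congrFun h 0, by simpa using congrFun h 1⟩
  · intro i
    fin_cases i <;> simp
  · intro q hq hline hp
    obtain ⟨c, rfl⟩ := hq.exists_eq_sum_of_two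
    have h00 := hline 1 0
    have h11 := hline 0 1
    have h01 := hline 1 1
    have h22 := hp 0
    have h33 := hp 1
    have h23 := hp 2
    have h02 := hp 3
    have h03 := hp 4
    have h12 := hp 5
    have h13 := hp 6
    simp [Fin.sum_univ_four] at h00 h11 h01 h22 h33 h23 h02 h03 h12 h13
    have e01 : c 0 1 = -c 1 0 := by linear_combination h01 - h00 - h11
    have e02 : c 0 2 = -c 2 0 := by linear_combination h02 - h00 - h22
    have e03 : c 0 3 = -c 3 0 := by linear_combination h03 - h00 - h33
    have e12 : c 1 2 = -c 2 1 := by linear_combination h12 - h11 - h22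
    have e13 : c 1 3 = -c 3 1 := by linear_combination h13 - h11 - h33
    have e23 : c 2 3 = -c 3 2 := by linear_combination h23 - h22 - h33
    simp only [Fin.sum_univ_four, h00, h11, h22, h33, e01, e02, e03, e12, e13, e23, C_neg, C_0]
    ring
end
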